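/- arXiv:2008.05391 — 2 statements merged into one kernel-verified Lean document; each statement's English description precedes it below -/
import Mathlib

section
/- For every run of the modified greedy algorithm and every OPT ⊆ V with c(OPT) ≤ b, it holds that f(S_m) ≥ α* · f(OPT), where α* := sInf { α ∈ [0,1] | ∃ x1 x2 x3 x4 x5 x6 ∈ [0,1] such that: α ≥ x1; (x4 > 0 → α ≥ x1 + (1 − exp((x4 + x6 − 1)/x4))·x3); α ≥ x2; (x5 > 0 → x1 ≥ (1 − 1/e)·(1 − 2α) + (x4 + x5 + x6 − 1)·x2/x5); x1 ≥ 1 − exp(−x4); x1 + x2 + x3 ≥ 1; (x5 > 0 → x1 + x2/x5 ≥ 1); and x4 + x5 ≥ 1 }. -/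
open Finset

section Submodular

variable {V : Type*} [DecidableEq V] {f : Finset V → ℝ}

lemma marginal_antitone (hmono : ∀ S T : Finset V, S ⊆ T → f S ≤ f T)
    (hsub : ∀ S T : Finset V, f (S ∪ T) + f (S ∩ T) ≤ f S + f T)
    {S T : Finset V} (hST : S ⊆ T) (v : V) :
    f (insert v T) - f T ≤ f (insert v S) - f S := by
  by_cases hv : v ∈ T
  · rw [insert_eq_of_mem hv]
    linarith [hmono S (insert v S) (subset_insert v S)]
  · have h := hsub (insert v S) T
    rw [insert_union, union_eq_right.2 hST, insert_inter_of_notMem hv,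
      inter_eq_left.2 hST] at h
    linarith

lemma union_sub_le_sum_marginal (hmono : ∀ S T : Finset V, S ⊆ T → f S ≤ f T)
    (hsub : ∀ S T : Finset V, f (S ∪ T) + f (S ∩ T) ≤ f S + f T)
    (O B : Finset V) :
    f (O ∪ B) - f B ≤ ∑ o ∈ O, (f (insert o B) - f B) := by
  induction O using Finset.induction_on with
  | empty => simp
  | insert a O ha ih =>
    rw [sum_insert ha, insert_union]
    linarith [marginal_antitone hmono hsub (subset_union_right (s₁ := O) (s₂ := B)) a]

end Submodular

/-- If the value `m` grows at rate at least `s` and at least `(F - m) / C` with respect to the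
cost `a`, then it dominates an exponential phase of length `t` followed by a linear phase. -/
lemma exp_linear_growth (a m : ℕ → ℝ) (C F s : ℝ) (hC : 0 < C) (hF : 0 ≤ F) (hs : 0 ≤ s)
    (ha0 : a 0 = 0) (hm0 : m 0 = 0) (n : ℕ)
    (ha : ∀ i < n, a i ≤ a (i + 1))
    (hlin : ∀ i < n, s * (a (i + 1) - a i) ≤ m (i + 1) - m i)
    (hexp : ∀ i < n, (F - m i) * (a (i + 1) - a i) ≤ (m (i + 1) - m i) * C) :
    ∀ t, 0 ≤ t → t ≤ a n → (1 - Real.exp (-t / C)) * F + s * (a n - t) ≤ m n := by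
  induction n with
  | zero =>
    intro t h0 h1
    have : t = 0 := by linarith
    subst this
    simp [ha0, hm0]
  | succ n ih =>
    have IH := ih (fun i hi => ha i (by omega)) (fun i hi => hlin i (by omega))
      (fun i hi => hexp i (by omega))
    intro t h0 h1
    have hl := hlin n (by omega)
    have he := hexp n (by omega)
    have han := ha n (by omega)
    have hanonneg : 0 ≤ a n := by
      clear IH hl he h1 hexp hlin ih
      induction n with
      | zero => exact ha0.ge
      | succ k ihk =>
        have hk := ha k (by omega)
        exact (ihk (fun i hi => ha i (by omega)) hk).trans hk
    rcases le_total t (a n) with htn | htn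
    · have := IH t h0 htn
      linarith
    · rcases le_or_gt F (m n) with hFm | hFm
      · have h2 : 0 ≤ Real.exp (-t / C) * F := by positivity
        have h3 : s * (a (n + 1) - t) ≤ s * (a (n + 1) - a n) := by gcongr
        linarith
      · have hn := IH (a n) hanonneg le_rfl
        set δ := t - a n with hδ
        have hδ0 : 0 ≤ δ := by linarith
        have hsplit : Real.exp (-t / C) = Real.exp (-δ / C) * Real.exp (-(a n) / C) := by
          rw [← Real.exp_add]; congr 1; rw [hδ]; ring
        have h1e : 1 - δ / C ≤ Real.exp (-δ / C) := by
          have := Real.add_one_le_exp (-δ / C)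
          rw [neg_div] at *
          linarith
        have hdecay : (F - m n) * (1 - δ / C) ≤ Real.exp (-t / C) * F := by
          calc (F - m n) * (1 - δ / C) ≤ (F - m n) * Real.exp (-δ / C) := by
                have : 0 ≤ F - m n := by linarith
                gcongr
            _ ≤ (Real.exp (-(a n) / C) * F) * Real.exp (-δ / C) := by
                gcongr; linarith
            _ = _ := by rw [hsplit]; ring
        have hgain : (F - m n) * (δ / C) + s * (a (n + 1) - t) ≤ m (n + 1) - m n := by
          rcases eq_or_lt_of_le han with heq | hlt
          · have hz : δ = 0 := by linarith
            have hz2 : a (n + 1) - t = 0 := by linarith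
            rw [hz, hz2]
            rw [heq] at hl
            simp at hl ⊢
            exact hl
          · set L := a (n + 1) - a n with hL
            have hLpos : 0 < L := by rw [hL]; linarith
            have hd1 : (F - m n) / C ≤ (m (n + 1) - m n) / L := by
              rw [div_le_div_iff₀ hC hLpos]; exact he
            have hd2 : s ≤ (m (n + 1) - m n) / L := by
              rw [le_div_iff₀ hLpos]; exact hl
            have hrest : 0 ≤ a (n + 1) - t := by linarith
            calc (F - m n) * (δ / C) + s * (a (n + 1) - t)
                = (F - m n) / C * δ + s * (a (n + 1) - t) := by ring
              _ ≤ (m (n + 1) - m n) / L * δ + (m (n + 1) - m n) / L * (a (n + 1) - t) := by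
                  gcongr
              _ = (m (n + 1) - m n) / L * L := by rw [hL, hδ]; ring
              _ = _ := by field_simp
        linarith

/-- A run of the greedy heuristic with budget `b` on a monotone submodular function. -/
structure IsGreedyRun {V : Type*} [DecidableEq V] (f : Finset V → ℝ) (c : V → ℝ) (b : ℝ)
    (n : ℕ) (u : ℕ → V) (B : ℕ → Finset V) : Prop where
  map_empty : f ∅ = 0
  mono : ∀ S T : Finset V, S ⊆ T → f S ≤ f T
  submodular : ∀ S T : Finset V, f (S ∪ T) + f (S ∩ T) ≤ f S + f T
  cost_pos : ∀ v, 0 < c v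
  budget_pos : 0 < b
  zero : B 0 = ∅
  accept : ∀ i < n, (∑ v ∈ B i, c v) + c (u i) ≤ b → B (i + 1) = insert (u i) (B i)
  reject : ∀ i < n, ¬ ((∑ v ∈ B i, c v) + c (u i) ≤ b) → B (i + 1) = B i
  greedy : ∀ i j, i ≤ j → j < n →
    (f (insert (u j) (B i)) - f (B i)) * c (u i) ≤ (f (insert (u i) (B i)) - f (B i)) * c (u j)
  surj : ∀ v, ∃ i < n, u i = v

namespace IsGreedyRun

variable {V : Type*} [DecidableEq V] {f : Finset V → ℝ} {c : V → ℝ} {b : ℝ}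
  {n : ℕ} {u : ℕ → V} {B : ℕ → Finset V}

lemma step (h : IsGreedyRun f c b n u B) {i : ℕ} (hi : i < n) :
    B (i + 1) = B i ∨ (u i ∉ B i ∧ B (i + 1) = insert (u i) (B i)) := by
  by_cases hr : (∑ v ∈ B i, c v) + c (u i) ≤ b
  · by_cases hm : u i ∈ B i
    · left; rw [h.accept i hi hr, insert_eq_of_mem hm]
    · exact Or.inr ⟨hm, h.accept i hi hr⟩
  · exact Or.inl (h.reject i hi hr)

lemma subset_of_le (h : IsGreedyRun f c b n u B) {i j : ℕ} (hij : i ≤ j) (hj : j ≤ n) :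
    B i ⊆ B j := by
  induction j, hij using Nat.le_induction with
  | base => exact subset_rfl
  | succ j hij ih =>
    refine (ih (by omega)).trans ?_
    rcases h.step (show j < n by omega) with h1 | ⟨-, h1⟩ <;> rw [h1]
    exact subset_insert _ _

lemma cost_le_budget (h : IsGreedyRun f c b n u B) {i : ℕ} (hi : i ≤ n) :
    ∑ v ∈ B i, c v ≤ b := by
  induction i with
  | zero => simpa [h.zero] using h.budget_pos.le
  | succ i ih =>
    by_cases hr : (∑ v ∈ B i, c v) + c (u i) ≤ b
    · rw [h.accept i hi hr]
      by_cases hm : u i ∈ B i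
      · rw [insert_eq_of_mem hm]; exact ih (by omega)
      · rw [sum_insert hm]; linarith
    · rw [h.reject i hi hr]; exact ih (by omega)

lemma nonneg (h : IsGreedyRun f c b n u B) (S : Finset V) : 0 ≤ f S := by
  simpa [h.map_empty] using h.mono ∅ S (empty_subset S)

lemma mem_or_later (h : IsGreedyRun f c b n u B) {q i : ℕ} (hi : i ≤ q) (hq : q ≤ n) {v : V}
    (hv : ∀ j < q, u j = v → (∑ w ∈ B j, c w) + c (u j) ≤ b) :
    v ∈ B i ∨ ∃ j, i ≤ j ∧ j < n ∧ u j = v := by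
  obtain ⟨j, hj, rfl⟩ := h.surj v
  rcases le_or_gt i j with hij | hij
  · exact Or.inr ⟨j, hij, hj, rfl⟩
  · left
    have hacc := h.accept j hj (hv j (by omega) rfl)
    exact h.subset_of_le (show j + 1 ≤ i from hij) (by omega) (by simp [hacc])

/-- The density of the next considered element is at least the average density of `O`, provided
no element of `O` has been rejected so far. -/
lemma density_bound (h : IsGreedyRun f c b n u B) {i : ℕ} (hi : i < n) (O : Finset V)
    (hO : ∀ j < i, u j ∈ O → (∑ w ∈ B j, c w) + c (u j) ≤ b) :
    (f (O ∪ B i) - f (B i)) * c (u i) ≤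
      (f (insert (u i) (B i)) - f (B i)) * ∑ v ∈ O, c v := by
  calc (f (O ∪ B i) - f (B i)) * c (u i)
      ≤ (∑ o ∈ O, (f (insert o (B i)) - f (B i))) * c (u i) := by
        have := (h.cost_pos (u i)).le
        gcongr
        exact union_sub_le_sum_marginal h.mono h.submodular O (B i)
    _ = ∑ o ∈ O, (f (insert o (B i)) - f (B i)) * c (u i) := sum_mul _ _ _
    _ ≤ ∑ o ∈ O, (f (insert (u i) (B i)) - f (B i)) * c o := by
        refine sum_le_sum fun o ho => ?_
        rcases h.mem_or_later le_rfl hi.le (v := o)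
          (fun j hj hjo => hO j hj (hjo ▸ ho)) with hm | ⟨j, hij, hjn, rfl⟩
        · rw [insert_eq_of_mem hm, sub_self, zero_mul]
          exact mul_nonneg (sub_nonneg.2 (h.mono _ _ (subset_insert _ _))) (h.cost_pos o).le
        · exact h.greedy i j hij hjn
    _ = _ := (mul_sum _ _ _).symm

lemma run_bound (h : IsGreedyRun f c b n u B) {p q : ℕ} (hpq : p ≤ q) (hq : q ≤ n)
    (O : Finset V) (hO : ∀ j < q, u j ∈ O → (∑ w ∈ B j, c w) + c (u j) ≤ b)
    {C s : ℝ} (hC : 0 < C) (hOC : ∑ v ∈ O, c v ≤ C) (hs : 0 ≤ s)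
    (hslope : ∀ i, p ≤ i → i < q → s * c (u i) ≤ f (insert (u i) (B i)) - f (B i))
    {t : ℝ} (ht0 : 0 ≤ t) (ht : t ≤ ∑ v ∈ B q, c v - ∑ v ∈ B p, c v) :
    (1 - Real.exp (-t / C)) * (f (O ∪ B p) - f (B p)) +
      s * (∑ v ∈ B q, c v - ∑ v ∈ B p, c v - t) ≤ f (B q) - f (B p) := by
  have key := exp_linear_growth (fun i => ∑ v ∈ B (p + i), c v - ∑ v ∈ B p, c v)
    (fun i => f (B (p + i)) - f (B p)) C (f (O ∪ B p) - f (B p)) s hC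
    (sub_nonneg.2 (h.mono _ _ subset_union_right)) hs (by simp) (by simp) (q - p)
  simp only [Nat.add_sub_cancel' hpq] at key
  refine key ?_ ?_ ?_ t ht0 ht
  all_goals
    intro i hi
    rw [← add_assoc]
    have hin : p + i < n := by omega
    rcases h.step hin with h1 | ⟨hm, h1⟩
    · simp [h1]
    rw [h1, sum_insert hm]
  · linarith [h.cost_pos (u (p + i))]
  · have := hslope (p + i) (by omega) (by omega)
    linarith
  · have hd := h.density_bound hin O fun j hj => hO j (by omega)
    have hle : f (O ∪ B p) ≤ f (O ∪ B (p + i)) :=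
      h.mono _ _ (union_subset_union_right (h.subset_of_le (by omega) hin.le))
    have hg : 0 ≤ f (insert (u (p + i)) (B (p + i))) - f (B (p + i)) :=
      sub_nonneg.2 (h.mono _ _ (subset_insert _ _))
    calc _ = (f (O ∪ B p) - f (B (p + i))) * c (u (p + i)) := by ring
      _ ≤ (f (O ∪ B (p + i)) - f (B (p + i))) * c (u (p + i)) := by
          have := (h.cost_pos (u (p + i))).le
          gcongr
      _ ≤ (f (insert (u (p + i)) (B (p + i))) - f (B (p + i))) * ∑ v ∈ O, c v := hd
      _ ≤ (f (insert (u (p + i)) (B (p + i))) - f (B (p + i))) * C := by gcongr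
      _ = _ := by ring

end IsGreedyRun

/-- Feasibility of the ratio `α` in the factor-revealing optimization problem. -/
def FactorFeasible (α : ℝ) : Prop :=
  α ∈ Set.Icc (0 : ℝ) 1 ∧
    ∃ x1 x2 x3 x4 x5 x6 : ℝ,
      x1 ∈ Set.Icc (0 : ℝ) 1 ∧ x2 ∈ Set.Icc (0 : ℝ) 1 ∧
      x3 ∈ Set.Icc (0 : ℝ) 1 ∧ x4 ∈ Set.Icc (0 : ℝ) 1 ∧
      x5 ∈ Set.Icc (0 : ℝ) 1 ∧ x6 ∈ Set.Icc (0 : ℝ) 1 ∧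
      α ≥ x1 ∧
      (0 < x4 → α ≥ x1 + (1 - Real.exp ((x4 + x6 - 1) / x4)) * x3) ∧
      α ≥ x2 ∧
      (0 < x5 → x1 ≥ (1 - 1 / Real.exp 1) * (1 - 2 * α) +
        (x4 + x5 + x6 - 1) * x2 / x5) ∧
      x1 ≥ 1 - Real.exp (-x4) ∧
      x1 + x2 + x3 ≥ 1 ∧
      (0 < x5 → x1 + x2 / x5 ≥ 1) ∧
      x4 + x5 ≥ 1

lemma factorFeasible_one : FactorFeasible 1 := by
  refine ⟨by simp, 1, 0, 0, 0, 1, 0, by simp, by simp, by simp, by simp, by simp, by simp,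
    by simp, by simp, by simp, ?_, by simp, by simp, by simp, by simp⟩
  intro _
  have h1 : 1 / Real.exp 1 ≤ 1 := by
    rw [div_le_one (Real.exp_pos 1)]
    exact Real.one_le_exp zero_le_one
  linarith

/-- The unnormalized version of the constraints, with `M` the algorithm's value, `Z` the optimal
value, `b` the budget, `a` and `g` the cost and value of the greedy set when the first optimal
element (of cost `k` and marginal value `d`) is rejected, `r` the marginal value of the remaining
optimal elements, and `w` the cost of the second rejected optimal element. -/
lemma factorFeasible_div {M Z b a g k d r w : ℝ} (hZ : 0 < Z) (hb : 0 < b) (hMZ : M ≤ Z)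
    (hg : 0 ≤ g) (hd : 0 ≤ d) (hr : 0 ≤ r) (ha : 0 ≤ a) (hk : 0 < k) (hw : 0 ≤ w)
    (hrZ : r ≤ Z) (hab : a ≤ b) (hkb : k ≤ b) (hwb : w ≤ b)
    (hgM : g ≤ M) (hdM : d ≤ M)
    (h2 : 0 < a → g + (1 - Real.exp ((a + w - b) / a)) * r ≤ M)
    (h4 : (1 - 1 / Real.exp 1) * (Z - 2 * M) + (a + k + w - b) * d / k ≤ g)
    (h5 : (1 - Real.exp (-a / b)) * Z ≤ g)
    (h6 : Z ≤ g + d + r) (h7 : Z * k ≤ g * k + d * b) (h8 : b ≤ a + k) :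
    FactorFeasible (M / Z) := by
  have hM : 0 ≤ M := hg.trans hgM
  refine ⟨⟨by positivity, by rw [div_le_one hZ]; exact hMZ⟩, g / Z, d / Z, r / Z, a / b, k / b,
    w / b, ⟨by positivity, ?_⟩, ⟨by positivity, ?_⟩, ⟨by positivity, ?_⟩, ⟨by positivity, ?_⟩,
    ⟨by positivity, ?_⟩, ⟨by positivity, ?_⟩, ?_, ?_, ?_, ?_, ?_, ?_, ?_, ?_⟩
  · rw [div_le_one hZ]; linarith
  · rw [div_le_one hZ]; linarith
  · rw [div_le_one hZ]; linarith
  · rw [div_le_one hb]; linarith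
  · rw [div_le_one hb]; linarith
  · rw [div_le_one hb]; linarith
  · show g / Z ≤ M / Z
    gcongr
  · intro h
    have ha' : 0 < a := (div_pos_iff_of_pos_right hb).1 h
    have he : (a / b + w / b - 1) / (a / b) = (a + w - b) / a := by field_simp
    rw [he, ge_iff_le, le_div_iff₀ hZ]
    have := h2 ha'
    have e : (g / Z + (1 - Real.exp ((a + w - b) / a)) * (r / Z)) * Z =
      g + (1 - Real.exp ((a + w - b) / a)) * r := by field_simp
    rw [e]; exact this
  · show d / Z ≤ M / Z
    gcongr
  · intro _
    rw [ge_iff_le, le_div_iff₀ hZ]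
    refine le_trans (le_of_eq ?_) h4
    field_simp
  · rw [ge_iff_le, le_div_iff₀ hZ, ← neg_div]; exact h5
  · have : g / Z + d / Z + r / Z = (g + d + r) / Z := by ring
    rw [this, ge_iff_le, le_div_iff₀ hZ]; linarith
  · intro _
    have : g / Z + d / Z / (k / b) = (g * k + d * b) / (Z * k) := by field_simp
    rw [this, ge_iff_le, le_div_iff₀ (by positivity)]; linarith
  · have : a / b + k / b = (a + k) / b := by ring
    rw [this, ge_iff_le, le_div_iff₀ hb]; linarith

namespace IsGreedyRun

variable {V : Type*} [DecidableEq V] {f : Finset V → ℝ} {c : V → ℝ} {b : ℝ}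
  {n : ℕ} {u : ℕ → V} {B : ℕ → Finset V}

lemma subset_of_never_rejected (h : IsGreedyRun f c b n u B) (O : Finset V)
    (hO : ∀ j < n, u j ∈ O → (∑ w ∈ B j, c w) + c (u j) ≤ b) : O ⊆ B n := by
  intro o ho
  rcases h.mem_or_later le_rfl le_rfl (v := o) (fun j hj hjo => hO j hj (hjo ▸ ho)) with
    hm | ⟨j, hnj, hjn, -⟩
  · exact hm
  · omega

lemma value_insert_le (h : IsGreedyRun f c b n u B) (v : V) (S : Finset V) :
    f (insert v S) ≤ f {v} + f S := by
  have := marginal_antitone h.mono h.submodular (empty_subset S) v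
  rw [h.map_empty, insert_empty_eq] at this
  linarith

/-- The linear phase: reaching cost `T` on `O ⊆ OPT` gives a factor `1 - 1/e` of `f O`, and
afterwards the density is at least that of the rejected element. -/
lemma value_ge_of_density (h : IsGreedyRun f c b n u B) {p : ℕ} (hp : p ≤ n) (O : Finset V)
    (hO : ∀ j < p, u j ∈ O → (∑ w ∈ B j, c w) + c (u j) ≤ b)
    {T s y : ℝ} (hOT : ∑ v ∈ O, c v ≤ T) (hT : T ≤ ∑ v ∈ B p, c v) (hs : 0 ≤ s)
    (hslope : ∀ i < p, s * c (u i) ≤ f (insert (u i) (B i)) - f (B i)) (hy : y ≤ f O) :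
    (1 - 1 / Real.exp 1) * y + (∑ v ∈ B p, c v - T) * s ≤ f (B p) := by
  have hT0 : 0 ≤ T := (sum_nonneg fun v _ => (h.cost_pos v).le).trans hOT
  have hfac : 0 ≤ 1 - 1 / Real.exp 1 := by
    rw [sub_nonneg, div_le_one (Real.exp_pos 1)]
    exact Real.one_le_exp zero_le_one
  rcases hT0.eq_or_lt with rfl | hTpos
  · have hOe : O = ∅ := by
      by_contra hne
      have := sum_pos (fun v _ => h.cost_pos v) (nonempty_iff_ne_empty.2 hne)
      linarith
    subst hOe
    have := h.run_bound (Nat.zero_le p) hp ∅ (by simp) one_pos (by simp) hs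
      (fun i _ hi => hslope i hi) le_rfl (by simpa [h.zero] using hT)
    simp [h.zero, h.map_empty] at this hy ⊢
    have h3 : (1 - (Real.exp 1)⁻¹) * y ≤ 0 :=
      mul_nonpos_of_nonneg_of_nonpos (by simpa using hfac) hy
    linarith
  · have := h.run_bound (Nat.zero_le p) hp O hO hTpos hOT hs
      (fun i _ hi => hslope i hi) hT0 (by simpa [h.zero] using hT)
    rw [h.zero, union_empty, h.map_empty, sum_empty, neg_div, div_self hTpos.ne',
      Real.exp_neg, ← one_div] at this
    have h3 : (1 - 1 / Real.exp 1) * y ≤ (1 - 1 / Real.exp 1) * f O := by gcongr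
    linarith

lemma factorFeasible (h : IsGreedyRun f c b n u B) (hcb : ∀ v, c v ≤ b) (OPT : Finset V)
    (hOPT : ∑ v ∈ OPT, c v ≤ b) {M : ℝ} (hBM : f (B n) ≤ M) (hvM : ∀ v, f {v} ≤ M)
    (hZ : 0 < f OPT) (hMZ : M < f OPT) : FactorFeasible (M / f OPT) := by
  classical
  have hex : ∃ k, k < n ∧ u k ∈ OPT ∧ ¬ ((∑ w ∈ B k, c w) + c (u k) ≤ b) := by
    by_contra! hno
    have := h.mono _ _ (h.subset_of_never_rejected OPT hno)
    linarith
  obtain ⟨k, ⟨hkn, hkO, hkr⟩, hkmin⟩ : ∃ k, (k < n ∧ u k ∈ OPT ∧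
      ¬ ((∑ w ∈ B k, c w) + c (u k) ≤ b)) ∧
      ∀ j < k, u j ∈ OPT → (∑ w ∈ B j, c w) + c (u j) ≤ b := by
    refine ⟨Nat.find hex, Nat.find_spec hex, fun j hj hjO => ?_⟩
    have := Nat.find_min hex hj
    by_contra hc
    exact this ⟨hj.trans (Nat.find_spec hex).1, hjO, hc⟩
  set P := OPT.erase (u k) with hP
  have hPO : P ⊆ OPT := erase_subset _ _
  have hPins : insert (u k) P = OPT := insert_erase hkO
  have hPcost : ∑ v ∈ P, c v + c (u k) = ∑ v ∈ OPT, c v := sum_erase_add _ _ hkO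
  set d := f (insert (u k) (B k)) - f (B k) with hd
  set r := f (P ∪ B k) - f (B k) with hr
  have hckpos := h.cost_pos (u k)
  have hd0 : 0 ≤ d := sub_nonneg.2 (h.mono _ _ (subset_insert _ _))
  have hr0 : 0 ≤ r := sub_nonneg.2 (h.mono _ _ subset_union_right)
  have hdu : d ≤ f {u k} := by linarith [h.value_insert_le (u k) (B k)]
  have hBk : f (B k) ≤ f (B n) := h.mono _ _ (h.subset_of_le hkn.le le_rfl)
  have hslope : ∀ i < k, d / c (u k) * c (u i) ≤ f (insert (u i) (B i)) - f (B i) := by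
    intro i hi
    rw [div_mul_eq_mul_div, div_le_iff₀ hckpos]
    refine le_trans ?_ (h.greedy i k hi.le hkn)
    have := (h.cost_pos (u i)).le
    gcongr
    exact marginal_antitone h.mono h.submodular (h.subset_of_le hi.le hkn.le) _
  have hcover : f OPT ≤ f (B k) + d + r := by
    have h1 := h.mono OPT (P ∪ insert (u k) (B k)) (by
      rw [← hPins]; intro x; simp; tauto)
    have h2 := marginal_antitone h.mono h.submodular
      (subset_union_right (s₁ := P) (s₂ := B k)) (u k)
    rw [union_insert] at h1
    linarith
  have hrZ : r ≤ f OPT := by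
    have := h.submodular P (B k)
    linarith [h.nonneg (P ∩ B k), h.mono P OPT hPO]
  have hdens : f OPT * c (u k) ≤ f (B k) * c (u k) + d * b := by
    have h1 := h.density_bound hkn OPT hkmin
    have h2 : f OPT ≤ f (OPT ∪ B k) := h.mono _ _ subset_union_left
    have h3 : d * ∑ v ∈ OPT, c v ≤ d * b := by gcongr
    have h4 : f OPT * c (u k) ≤ f (OPT ∪ B k) * c (u k) := by gcongr
    linarith
  have hcost0 : 0 ≤ ∑ v ∈ B k, c v := sum_nonneg fun v _ => (h.cost_pos v).le
  have hexp : (1 - Real.exp (-(∑ v ∈ B k, c v) / b)) * f OPT ≤ f (B k) := by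
    have := h.run_bound (Nat.zero_le k) hkn.le OPT hkmin h.budget_pos hOPT (s := 0) le_rfl
      (fun i _ _ => by
        rw [zero_mul]; exact sub_nonneg.2 (h.mono _ _ (subset_insert _ _)))
      hcost0 (by simp [h.zero])
    simpa [h.zero, h.map_empty] using this
  have finish : ∀ w, 0 ≤ w → w ≤ b →
      (0 < ∑ v ∈ B k, c v → f (B k) +
        (1 - Real.exp ((∑ v ∈ B k, c v + w - b) / ∑ v ∈ B k, c v)) * r ≤ M) →
      (1 - 1 / Real.exp 1) * (f OPT - 2 * M) +
        (∑ v ∈ B k, c v + c (u k) + w - b) * d / c (u k) ≤ f (B k) →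
      FactorFeasible (M / f OPT) := fun w hw0 hwb h2 h4 =>
    factorFeasible_div hZ h.budget_pos hMZ.le (h.nonneg _) hd0 hr0 hcost0 hckpos hw0 hrZ
      (h.cost_le_budget hkn.le) (hcb _) hwb (hBk.trans hBM) (hdu.trans (hvM _)) h2 h4
      hexp hcover hdens (by linarith)
  have hPval : f OPT ≤ M + f P := by
    rw [← hPins]; linarith [h.value_insert_le (u k) P, hvM (u k)]
  by_cases hex2 : ∃ l, l < n ∧ u l ∈ P ∧ ¬ ((∑ w ∈ B l, c w) + c (u l) ≤ b)
  · obtain ⟨l, ⟨hln, hlP, hlr⟩, hlmin⟩ : ∃ l, (l < n ∧ u l ∈ P ∧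
        ¬ ((∑ w ∈ B l, c w) + c (u l) ≤ b)) ∧
        ∀ j < l, u j ∈ P → (∑ w ∈ B j, c w) + c (u j) ≤ b := by
      refine ⟨Nat.find hex2, Nat.find_spec hex2, fun j hj hjO => ?_⟩
      have := Nat.find_min hex2 hj
      by_contra hc
      exact this ⟨hj.trans (Nat.find_spec hex2).1, hjO, hc⟩
    have hkl : k ≤ l := by
      by_contra! hlk
      exact hlr (hkmin l hlk (hPO hlP))
    have hQcost : ∑ v ∈ P.erase (u l), c v + c (u l) = ∑ v ∈ P, c v := sum_erase_add _ _ hlP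
    have hBl : f (B l) ≤ M := (h.mono _ _ (h.subset_of_le hln.le le_rfl)).trans hBM
    refine finish (c (u l)) (h.cost_pos _).le (hcb _) (fun hpos => ?_) ?_
    · set D := ∑ v ∈ B l, c v - ∑ v ∈ B k, c v with hD
      have hD0 : 0 ≤ D := sub_nonneg.2 <| sum_le_sum_of_subset_of_nonneg
        (h.subset_of_le hkl hln.le) fun v _ _ => (h.cost_pos v).le
      have := h.run_bound hkl hln.le P hlmin hpos (by linarith) (s := 0) le_rfl
        (fun i _ _ => by
          rw [zero_mul]; exact sub_nonneg.2 (h.mono _ _ (subset_insert _ _)))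
        hD0 le_rfl
      have hmon : Real.exp (-D / ∑ v ∈ B k, c v) ≤
          Real.exp ((∑ v ∈ B k, c v + c (u l) - b) / ∑ v ∈ B k, c v) := by
        gcongr
        linarith
      have h5 : (1 - Real.exp ((∑ v ∈ B k, c v + c (u l) - b) / ∑ v ∈ B k, c v)) * r ≤
          (1 - Real.exp (-D / ∑ v ∈ B k, c v)) * r := by gcongr
      linarith
    · have h6 := h.value_ge_of_density hkn.le (P.erase (u l))
        (fun j hj hjP => hkmin j hj (hPO (mem_of_mem_erase hjP)))
        (T := b - c (u k) - c (u l)) (s := d / c (u k)) (y := f OPT - 2 * M)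
        (by linarith) (by linarith [h.cost_pos (u l)]) (by positivity) hslope (by
          have := h.value_insert_le (u l) (P.erase (u l))
          rw [insert_erase hlP] at this
          linarith [hvM (u l)])
      refine le_trans (le_of_eq ?_) h6
      ring
  · push Not at hex2
    have hM0 : 0 ≤ M := (h.nonneg _).trans hBM
    refine finish 0 le_rfl h.budget_pos.le (fun _ => ?_) ?_
    · have h5 := h.mono (P ∪ B k) (B n)
        (union_subset (h.subset_of_never_rejected P hex2) (h.subset_of_le hkn.le le_rfl))
      have h6 : 0 ≤ Real.exp ((∑ v ∈ B k, c v + 0 - b) / ∑ v ∈ B k, c v) * r := by positivity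
      linarith
    · have h6 := h.value_ge_of_density hkn.le P
        (fun j hj hjP => hkmin j hj (hPO hjP))
        (T := b - c (u k)) (s := d / c (u k)) (y := f OPT - 2 * M)
        (by linarith) (by linarith) (by positivity) hslope (by linarith)
      refine le_trans (le_of_eq ?_) h6
      ring

end IsGreedyRun

/-- Lemma 3.7: the modified greedy solution satisfies f(S_m) ≥ α* · f(OPT), where
α* is the infimum of the constructed optimization problem. -/
theorem stmt8 {V : Type*} [Fintype V] [DecidableEq V] [Nonempty V]
    (f : Finset V → ℝ) (c : V → ℝ) (b : ℝ)
    (hf0 : f ∅ = 0)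
    (hmono : ∀ S T : Finset V, S ⊆ T → f S ≤ f T)
    (hsub : ∀ S T : Finset V, f (S ∪ T) + f (S ∩ T) ≤ f S + f T)
    (hcpos : ∀ v : V, 0 < c v)
    (hb : 0 < b)
    (hcb : ∀ v : V, c v ≤ b)
    (u : Fin (Fintype.card V) → V) (hu : Function.Bijective u)
    (A : Fin (Fintype.card V + 1) → Finset V)
    (hA0 : A 0 = ∅)
    (hstep : ∀ i : Fin (Fintype.card V),
      ((∑ v ∈ A i.castSucc, c v) + c (u i) ≤ b →
        A i.succ = insert (u i) (A i.castSucc)) ∧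
      (¬ ((∑ v ∈ A i.castSucc, c v) + c (u i) ≤ b) →
        A i.succ = A i.castSucc))
    (hgreedy : ∀ i j : Fin (Fintype.card V), i ≤ j →
      (f (insert (u i) (A i.castSucc)) - f (A i.castSucc)) * c (u j) ≥
      (f (insert (u j) (A i.castSucc)) - f (A i.castSucc)) * c (u i))
    (OPT : Finset V) (hOPT : ∑ v ∈ OPT, c v ≤ b) :
    max (f (A (Fin.last (Fintype.card V))))
      (Finset.univ.sup' Finset.univ_nonempty fun v : V => f {v}) ≥
    sInf {α : ℝ | α ∈ Set.Icc (0 : ℝ) 1 ∧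
      ∃ x1 x2 x3 x4 x5 x6 : ℝ,
        x1 ∈ Set.Icc (0 : ℝ) 1 ∧ x2 ∈ Set.Icc (0 : ℝ) 1 ∧
        x3 ∈ Set.Icc (0 : ℝ) 1 ∧ x4 ∈ Set.Icc (0 : ℝ) 1 ∧
        x5 ∈ Set.Icc (0 : ℝ) 1 ∧ x6 ∈ Set.Icc (0 : ℝ) 1 ∧
        α ≥ x1 ∧
        (0 < x4 → α ≥ x1 + (1 - Real.exp ((x4 + x6 - 1) / x4)) * x3) ∧
        α ≥ x2 ∧
        (0 < x5 → x1 ≥ (1 - 1 / Real.exp 1) * (1 - 2 * α) +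
          (x4 + x5 + x6 - 1) * x2 / x5) ∧
        x1 ≥ 1 - Real.exp (-x4) ∧
        x1 + x2 + x3 ≥ 1 ∧
        (0 < x5 → x1 + x2 / x5 ≥ 1) ∧
        x4 + x5 ≥ 1} * f OPT := by
  classical
  set M := max (f (A (Fin.last (Fintype.card V))))
      (Finset.univ.sup' Finset.univ_nonempty fun v : V => f {v}) with hM
  have hBM : f (A (Fin.last (Fintype.card V))) ≤ M := le_max_left _ _
  have hvM : ∀ v, f {v} ≤ M := fun v =>
    (Finset.le_sup' (fun v : V => f {v}) (Finset.mem_univ v)).trans (le_max_right _ _)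
  have hOPT0 : 0 ≤ f OPT := by simpa [hf0] using hmono ∅ OPT (empty_subset _)
  have hM0 : 0 ≤ M := le_trans (by simpa [hf0] using hmono ∅ _ (empty_subset _)) hBM
  rcases hOPT0.eq_or_lt with hZ | hZ
  · rw [← hZ, mul_zero]; exact hM0
  change sInf {α : ℝ | FactorFeasible α} * f OPT ≤ M
  have hbdd : BddBelow {α : ℝ | FactorFeasible α} := ⟨0, fun α hα => hα.1.1⟩
  rcases le_or_gt (f OPT) M with hle | hlt
  · have : sInf {α : ℝ | FactorFeasible α} ≤ 1 := csInf_le hbdd factorFeasible_one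
    exact (mul_le_of_le_one_left hZ.le this).trans hle
  · rw [← le_div_iff₀ hZ]
    refine csInf_le hbdd ?_
    have hn : 0 < Fintype.card V := Fintype.card_pos
    have hrun : IsGreedyRun f c b (Fintype.card V)
        (fun i => if hi : i < Fintype.card V then u ⟨i, hi⟩ else u ⟨0, hn⟩)
        (fun i => if hi : i < Fintype.card V + 1 then A ⟨i, hi⟩ else ∅) := by
      refine ⟨hf0, hmono, hsub, hcpos, hb, by simpa using hA0, ?_, ?_, ?_, ?_⟩
      · intro i hi hle
        have hi' : i < Fintype.card V + 1 := by omega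
        simp only [hi, hi', Nat.add_lt_add_iff_right, dif_pos] at hle ⊢
        exact (hstep ⟨i, hi⟩).1 hle
      · intro i hi hle
        have hi' : i < Fintype.card V + 1 := by omega
        simp only [hi, hi', Nat.add_lt_add_iff_right, dif_pos] at hle ⊢
        exact (hstep ⟨i, hi⟩).2 hle
      · intro i j hij hj
        have hi : i < Fintype.card V := by omega
        have hi' : i < Fintype.card V + 1 := by omega
        simp only [hi, hi', hj, dif_pos]
        exact hgreedy ⟨i, hi⟩ ⟨j, hj⟩ hij
      · intro v
        obtain ⟨i, rfl⟩ := hu.2 v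
        exact ⟨i, i.2, by simp⟩
    refine hrun.factorFeasible hcb OPT hOPT ?_ hvM hZ hlt
    rw [dif_pos (Nat.lt_succ_self _)]
    exact hBM
end

section
/- For every run of the modified greedy algorithm and every OPT ⊆ V with c(OPT) ≤ b, it holds that f(S_m) ≥ (1 − 1/√e) · f(OPT), i.e., max (f S_g) (max_{v ∈ V} f {v}) ≥ (1 − exp(−1/2)) · f(OPT). -/
open Finset

/-- A run of the greedy heuristic for maximizing a normalized monotone submodular function `f`
under the knapsack constraint with costs `c` and budget `b`: the elements are considered in the
order `u`, and `A i` is the set accepted before the `i`-th element is considered. -/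
structure IsGreedyRun_s13 {V : Type*} [DecidableEq V] {n : ℕ} (f : Finset V → ℝ) (c : V → ℝ) (b : ℝ)
    (u : Fin n → V) (A : Fin (n + 1) → Finset V) : Prop where
  map_empty : f ∅ = 0
  mono : ∀ S T : Finset V, S ⊆ T → f S ≤ f T
  submodular : ∀ S T : Finset V, f (S ∪ T) + f (S ∩ T) ≤ f S + f T
  cost_pos : ∀ v : V, 0 < c v
  bijective : Function.Bijective u
  zero_eq : A 0 = ∅
  step : ∀ i : Fin n,
    ((∑ v ∈ A i.castSucc, c v) + c (u i) ≤ b → A i.succ = insert (u i) (A i.castSucc)) ∧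
    (¬ ((∑ v ∈ A i.castSucc, c v) + c (u i) ≤ b) → A i.succ = A i.castSucc)
  greedy : ∀ i j : Fin n, i ≤ j →
    (f (insert (u i) (A i.castSucc)) - f (A i.castSucc)) * c (u j) ≥
      (f (insert (u j) (A i.castSucc)) - f (A i.castSucc)) * c (u i)

/-- A monotone submodular function is bounded by its value on a base set plus the sum of the
marginal gains over that set. -/
theorem le_add_sum_marginal {V : Type*} [DecidableEq V] {f : Finset V → ℝ}
    (hmono : ∀ S T : Finset V, S ⊆ T → f S ≤ f T)
    (hsub : ∀ S T : Finset V, f (S ∪ T) + f (S ∩ T) ≤ f S + f T) (S T : Finset V) :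
    f T ≤ f S + ∑ v ∈ T, (f (insert v S) - f S) := by
  have key : f (S ∪ T) ≤ f S + ∑ v ∈ T, (f (insert v S) - f S) := by
    induction T using Finset.induction_on with
    | empty => simp
    | insert a T ha ih =>
      rw [sum_insert ha]
      have h := hsub (S ∪ T) (insert a S)
      have h₁ : S ∪ T ∪ insert a S = S ∪ insert a T := by ext; simp; tauto
      have h₂ : f S ≤ f ((S ∪ T) ∩ insert a S) :=
        hmono _ _ (subset_inter subset_union_left (subset_insert _ _))
      rw [h₁] at h
      linarith
  exact (hmono _ _ subset_union_right).trans key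

namespace IsGreedyRun_s13

variable {V : Type*} [DecidableEq V] {n : ℕ} {f : Finset V → ℝ} {c : V → ℝ} {b : ℝ}
  {u : Fin n → V} {A : Fin (n + 1) → Finset V}

theorem monotone (h : IsGreedyRun_s13 f c b u A) : Monotone A := by
  rw [Fin.monotone_iff_le_succ]
  intro i
  by_cases hi : (∑ v ∈ A i.castSucc, c v) + c (u i) ≤ b
  · rw [(h.step i).1 hi]
    exact subset_insert _ _
  · rw [(h.step i).2 hi]

theorem notMem_of_le (h : IsGreedyRun_s13 f c b u A) (k : Fin n) (j : Fin (n + 1)) :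
    j ≤ k.castSucc → u k ∉ A j := by
  induction j using Fin.induction with
  | zero => simp [h.zero_eq]
  | succ i ih =>
    intro hik
    have hlt : i < k := Fin.castSucc_lt_castSucc_iff.1 (Fin.castSucc_lt_succ.trans_le hik)
    have hmem := ih (Fin.castSucc_le_castSucc_iff.2 hlt.le)
    by_cases hi : (∑ v ∈ A i.castSucc, c v) + c (u i) ≤ b
    · rw [(h.step i).1 hi, mem_insert, not_or]
      exact ⟨fun he => hlt.ne' (h.bijective.1 he), hmem⟩
    · rwa [(h.step i).2 hi]

theorem budget_lt_of_rejected (h : IsGreedyRun_s13 f c b u A) {i : Fin n} (hi : u i ∉ A i.succ) :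
    b < (∑ v ∈ A i.castSucc, c v) + c (u i) := by
  by_contra! hle
  exact hi (by simp [(h.step i).1 hle])

/-- Either every element of `T` is accepted, or there is a first rejected one. -/
theorem subset_last_or_exists_first_rejected (h : IsGreedyRun_s13 f c b u A) (T : Finset V) :
    T ⊆ A (Fin.last n) ∨ ∃ i : Fin n, u i ∈ T ∧ u i ∉ A i.succ ∧
      ∀ k < i, u k ∈ T → u k ∈ A k.succ := by
  by_cases hex : ∃ i : Fin n, u i ∈ T ∧ u i ∉ A i.succ
  · right
    obtain ⟨i, hi, hmin⟩ := WellFounded.has_min (wellFounded_lt (α := Fin n))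
      {i | u i ∈ T ∧ u i ∉ A i.succ} hex
    refine ⟨i, hi.1, hi.2, fun k hk hkT => ?_⟩
    by_contra hkA
    exact hmin k ⟨hkT, hkA⟩ hk
  · left
    push Not at hex
    intro v hv
    obtain ⟨k, rfl⟩ := h.bijective.2 v
    exact h.monotone (Fin.le_last _) (hex k hv)

/-- If no element of `T` was rejected before the `k`-th step, the density of the element
considered in that step is at least the average density of `T`. -/
theorem gap_mul_cost_le (h : IsGreedyRun_s13 f c b u A) {T : Finset V} {C : ℝ}
    (hC : ∑ v ∈ T, c v ≤ C) {k : Fin n} (hk : ∀ l < k, u l ∈ T → u l ∈ A l.succ) :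
    (f T - f (A k.castSucc)) * c (u k) ≤
      (f (insert (u k) (A k.castSucc)) - f (A k.castSucc)) * C := by
  have hgain : 0 ≤ f (insert (u k) (A k.castSucc)) - f (A k.castSucc) :=
    sub_nonneg.2 (h.mono _ _ (subset_insert _ _))
  have hT := le_add_sum_marginal h.mono h.submodular (A k.castSucc) T
  calc (f T - f (A k.castSucc)) * c (u k)
      ≤ (∑ v ∈ T, (f (insert v (A k.castSucc)) - f (A k.castSucc))) * c (u k) :=
        mul_le_mul_of_nonneg_right (by linarith) (h.cost_pos _).le
    _ = ∑ v ∈ T, (f (insert v (A k.castSucc)) - f (A k.castSucc)) * c (u k) := sum_mul _ _ _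
    _ ≤ ∑ v ∈ T, (f (insert (u k) (A k.castSucc)) - f (A k.castSucc)) * c v := by
        refine sum_le_sum fun v hv => ?_
        obtain ⟨l, rfl⟩ := h.bijective.2 v
        rcases le_or_gt k l with hkl | hlk
        · exact h.greedy k l hkl
        · have hmem : u l ∈ A k.castSucc :=
            h.monotone (Fin.succ_le_castSucc_iff.2 hlk) (hk l hlk hv)
          rw [insert_eq_of_mem hmem, sub_self, zero_mul]
          exact mul_nonneg hgain (h.cost_pos _).le
    _ = (f (insert (u k) (A k.castSucc)) - f (A k.castSucc)) * ∑ v ∈ T, c v := (mul_sum _ _ _).symm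
    _ ≤ _ := mul_le_mul_of_nonneg_left hC hgain

/-- While no element of `T` is rejected, the gap to a target value `G ≤ f T` decays exponentially
in the cost spent. -/
theorem gap_le (h : IsGreedyRun_s13 f c b u A) {T : Finset V} {C G : ℝ} (hC0 : 0 < C)
    (hC : ∑ v ∈ T, c v ≤ C) (hG : G ≤ f T) (i j : Fin (n + 1)) :
    i ≤ j → (∀ l : Fin n, l.castSucc < j → u l ∈ T → u l ∈ A l.succ) → f (A j) ≤ G →
    G - f (A j) ≤
      (G - f (A i)) * Real.exp (-((∑ v ∈ A j, c v - ∑ v ∈ A i, c v) / C)) := by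
  induction j using Fin.induction with
  | zero =>
    intro hi _ _
    obtain rfl := Fin.le_zero_iff.1 hi
    simp
  | succ k ih =>
    intro hik hrej hfG
    rcases hik.eq_or_lt with rfl | hlt
    · simp
    have hfk : f (A k.castSucc) ≤ f (A k.succ) :=
      h.mono _ _ (h.monotone Fin.castSucc_lt_succ.le)
    have ih' := ih (Fin.le_castSucc_iff.2 hlt)
      (fun l hl => hrej l (hl.trans Fin.castSucc_lt_succ)) (hfk.trans hfG)
    by_cases hk : (∑ v ∈ A k.castSucc, c v) + c (u k) ≤ b
    · have hdens := h.gap_mul_cost_le hC (k := k)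
        (fun l hl => hrej l ((Fin.castSucc_lt_castSucc_iff.2 hl).trans Fin.castSucc_lt_succ))
      rw [← (h.step k).1 hk] at hdens
      have hsum : ∑ v ∈ A k.succ, c v = c (u k) + ∑ v ∈ A k.castSucc, c v := by
        rw [(h.step k).1 hk, sum_insert (h.notMem_of_le k _ le_rfl)]
      have hstep : (G - f (A k.castSucc)) * (c (u k) / C) ≤
          f (A k.succ) - f (A k.castSucc) := by
        rw [← mul_div_assoc, div_le_iff₀ hC0]
        exact (mul_le_mul_of_nonneg_right (by linarith) (h.cost_pos _).le).trans hdens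
      have hexp := Real.add_one_le_exp (-(c (u k) / C))
      calc G - f (A k.succ)
          ≤ (G - f (A k.castSucc)) * (-(c (u k) / C) + 1) := by linarith
        _ ≤ (G - f (A k.castSucc)) * Real.exp (-(c (u k) / C)) :=
            mul_le_mul_of_nonneg_left hexp (by linarith)
        _ ≤ _ := mul_le_mul_of_nonneg_right ih' (Real.exp_pos _).le
        _ = _ := by
            rw [mul_assoc, ← Real.exp_add, hsum]
            congr 2
            ring
    · rwa [(h.step k).2 hk]

end IsGreedyRun_s13

theorem four_sevenths_lt_exp_neg_half : 4 / 7 < Real.exp (-(1 / 2)) := by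
  have h := Real.exp_one_lt_d9
  have h₁ : Real.exp (1 / 2) * Real.exp (1 / 2) = Real.exp 1 := by
    rw [← Real.exp_add]; norm_num
  have h₂ : Real.exp (-(1 / 2)) * Real.exp (1 / 2) = 1 := by
    rw [← Real.exp_add]; norm_num
  have h₃ : Real.exp (1 / 2) < 7 / 4 := by nlinarith [Real.exp_pos (1 / 2)]
  nlinarith [Real.exp_pos (-(1 / 2))]

theorem exp_gap_bound {t : ℝ} (ht : t ≤ 1 / 2) :
    (Real.exp (-t) - (1 - Real.exp (-(1 / 2)))) * Real.exp (-(2 - 4 * t)) ≤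
      2 * Real.exp (-(1 / 2)) - 1 := by
  set q := Real.exp (-(1 / 2)) with hq
  set z := Real.exp (1 / 2 - t) with hz
  have hq4 : 4 / 7 < q := four_sevenths_lt_exp_neg_half
  have hz1 : 1 ≤ z := Real.one_le_exp (by linarith)
  have h₁ : Real.exp (-t) = q * z := by rw [hq, hz, ← Real.exp_add]; ring_nf
  have h₂ : Real.exp (-(2 - 4 * t)) = (z ^ 4)⁻¹ := by
    rw [hz, ← Real.exp_nat_mul, ← Real.exp_neg]; push_cast; ring_nf
  have h₃ : 1 + 4 * (z - 1) ≤ z ^ 4 := by nlinarith [sq_nonneg (z ^ 2 - 1), sq_nonneg (z - 1)]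
  rw [h₁, h₂, ← div_eq_mul_inv, div_le_iff₀ (by positivity)]
  nlinarith [mul_nonneg (sub_nonneg.2 hz1) (by linarith : 0 ≤ 7 * q - 4),
    mul_le_mul_of_nonneg_left h₃ (by linarith : 0 ≤ 2 * q - 1)]

/-- The value of the greedy output or of some singleton is at least `(1 - 1/√e) * f O`. -/
theorem IsGreedyRun_s13.exists_singleton_or_le {V : Type*} [DecidableEq V] {n : ℕ}
    {f : Finset V → ℝ} {c : V → ℝ} {b : ℝ} {u : Fin n → V} {A : Fin (n + 1) → Finset V}
    (h : IsGreedyRun_s13 f c b u A) (hb : 0 < b) {O : Finset V} (hO : ∑ v ∈ O, c v ≤ b) :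
    (∃ v, (1 - Real.exp (-(1 / 2))) * f O ≤ f {v}) ∨
      (1 - Real.exp (-(1 / 2))) * f O ≤ f (A (Fin.last n)) := by
  have hq4 := four_sevenths_lt_exp_neg_half
  have hF : 0 ≤ f O := h.map_empty ▸ h.mono _ _ (empty_subset O)
  have hlast (j : Fin (n + 1)) : f (A j) ≤ f (A (Fin.last n)) :=
    h.mono _ _ (h.monotone (Fin.le_last j))
  by_contra! hcon
  obtain ⟨hsing, hout⟩ := hcon
  have hq0 : 0 < Real.exp (-(1 / 2)) := Real.exp_pos _
  have hxF : (1 - Real.exp (-(1 / 2))) * f O ≤ f O := by nlinarith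
  have hxqF : (1 - Real.exp (-(1 / 2))) * f O ≤ Real.exp (-(1 / 2)) * f O := by nlinarith
  rcases h.subset_last_or_exists_first_rejected O with hsub | ⟨i, hiO, hiA, hi⟩
  · linarith [h.mono _ _ hsub]
  have hbi := h.budget_lt_of_rejected hiA
  have hgap := h.gap_le hb hO le_rfl 0 i.castSucc (Fin.zero_le _)
    (fun l hl => hi l (Fin.castSucc_lt_castSucc_iff.1 hl)) (by linarith [hlast i.castSucc])
  rw [h.zero_eq, h.map_empty, sum_empty, sub_zero, sub_zero] at hgap
  set t := (∑ v ∈ A i.castSucc, c v) / b with ht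
  have htb : ∑ v ∈ A i.castSucc, c v = t * b := by rw [ht]; field_simp
  have ht2 : t ≤ 1 / 2 := by
    by_contra! hlt
    have hexp : Real.exp (-t) ≤ Real.exp (-(1 / 2)) := Real.exp_le_exp.2 (by linarith)
    nlinarith [hlast i.castSucc, mul_le_mul_of_nonneg_left hexp hF]
  have hcO : c (u i) + ∑ v ∈ O.erase (u i), c v = ∑ v ∈ O, c v := add_sum_erase _ _ hiO
  have hfO : Real.exp (-(1 / 2)) * f O ≤ f (O.erase (u i)) := by
    have h₁ := h.submodular (O.erase (u i)) {u i}
    have h₂ : O.erase (u i) ∪ {u i} = O := by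
      rw [union_comm, ← insert_eq, insert_erase hiO]
    have h₃ : 0 ≤ f (O.erase (u i) ∩ {u i}) := h.map_empty ▸ h.mono _ _ (empty_subset _)
    rw [h₂] at h₁
    linarith [hsing (u i)]
  rcases h.subset_last_or_exists_first_rejected (O.erase (u i)) with hsub | ⟨j, hjO, hjA, hj⟩
  · linarith [h.mono _ _ hsub]
  have hij : i ≤ j := by
    by_contra! hji
    exact hjA (hi j hji (mem_of_mem_erase hjO))
  have hbj := h.budget_lt_of_rejected hjA
  have hcj : c (u j) ≤ ∑ v ∈ O.erase (u i), c v :=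
    single_le_sum (fun v _ => (h.cost_pos v).le) hjO
  have hC0 := (h.cost_pos (u j)).trans_le hcj
  have hgap' := h.gap_le hC0 le_rfl hfO i.castSucc j.castSucc
    (Fin.castSucc_le_castSucc_iff.2 hij)
    (fun l hl => hj l (Fin.castSucc_lt_castSucc_iff.1 hl)) (by linarith [hlast j.castSucc])
  set C := ∑ v ∈ O.erase (u i), c v
  have hCt : C ≤ t * b := by linarith
  have hrate : 2 - 4 * t ≤
      (∑ v ∈ A j.castSucc, c v - ∑ v ∈ A i.castSucc, c v) / C := by
    rw [le_div_iff₀ hC0]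
    nlinarith [mul_nonneg (sub_nonneg.2 hCt) (by linarith : 0 ≤ 3 - 4 * t),
      mul_nonneg hb.le (sq_nonneg (1 - 2 * t))]
  have hexp := Real.exp_le_exp.2 (neg_le_neg hrate)
  have hbound := mul_le_mul_of_nonneg_left (exp_gap_bound ht2) hF
  have h₁ : Real.exp (-(1 / 2)) * f O - f (A i.castSucc) ≤
      f O * (Real.exp (-t) - (1 - Real.exp (-(1 / 2)))) := by linarith
  have h₂ : 0 ≤ Real.exp (-(1 / 2)) * f O - f (A i.castSucc) := by linarith [hlast i.castSucc]
  have h₃ := mul_le_mul_of_nonneg_left hexp h₂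
  have h₄ := mul_le_mul_of_nonneg_right h₁ (Real.exp_pos (-(2 - 4 * t))).le
  linarith [hlast j.castSucc]

/-- Theorem 5.1: the modified greedy algorithm achieves approximation factor
(1 − 1/√e): f(S_m) ≥ (1 − exp(−1/2)) · f(OPT). -/
theorem stmt13 {V : Type*} [Fintype V] [DecidableEq V] [Nonempty V]
    (f : Finset V → ℝ) (c : V → ℝ) (b : ℝ)
    (hf0 : f ∅ = 0)
    (hmono : ∀ S T : Finset V, S ⊆ T → f S ≤ f T)
    (hsub : ∀ S T : Finset V, f (S ∪ T) + f (S ∩ T) ≤ f S + f T)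
    (hcpos : ∀ v : V, 0 < c v)
    (hb : 0 < b)
    (hcb : ∀ v : V, c v ≤ b)
    (u : Fin (Fintype.card V) → V) (hu : Function.Bijective u)
    (A : Fin (Fintype.card V + 1) → Finset V)
    (hA0 : A 0 = ∅)
    (hstep : ∀ i : Fin (Fintype.card V),
      ((∑ v ∈ A i.castSucc, c v) + c (u i) ≤ b →
        A i.succ = insert (u i) (A i.castSucc)) ∧
      (¬ ((∑ v ∈ A i.castSucc, c v) + c (u i) ≤ b) →
        A i.succ = A i.castSucc))
    (hgreedy : ∀ i j : Fin (Fintype.card V), i ≤ j →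
      (f (insert (u i) (A i.castSucc)) - f (A i.castSucc)) * c (u j) ≥
      (f (insert (u j) (A i.castSucc)) - f (A i.castSucc)) * c (u i))
    (OPT : Finset V) (hOPT : ∑ v ∈ OPT, c v ≤ b) :
    max (f (A (Fin.last (Fintype.card V))))
      (Finset.univ.sup' Finset.univ_nonempty fun v : V => f {v}) ≥
    (1 - Real.exp (-(1 / 2))) * f OPT := by
  have h : IsGreedyRun_s13 f c b u A := ⟨hf0, hmono, hsub, hcpos, hu, hA0, hstep, hgreedy⟩
  rcases h.exists_singleton_or_le hb hOPT with ⟨v, hv⟩ | hle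
  · exact le_max_of_le_right (hv.trans (le_sup' (fun v : V => f {v}) (mem_univ v)))
  · exact le_max_of_le_left hle
end
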